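/- Under Assumption 2.1, the stroboscopic map f satisfies f(x) > x for all x ∈ [0, x_border], where x_border = β/α_on + (x_ref − β/α_on)·e^{α_on}. -/

import Mathlib

/-- The border point `x_border`. -/
noncomputable def xBorder (α_on β x_ref : ℝ) : ℝ :=
  β / α_on + (x_ref - β / α_on) * Real.exp α_on

/-- The stroboscopic (period-1) map of the deterministic switching buck converter. -/
noncomputable def strobo (α_on α_off β x_ref : ℝ) (x : ℝ) : ℝ :=
  if x ≤ xBorder α_on β x_ref then
    β / α_on + (x - β / α_on) * Real.exp (-α_on)
  else
    x_ref * Real.exp (-α_off) *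
      ((β / α_on - x) / (β / α_on - x_ref)) ^ (α_off / α_on)

theorem strobo_gt_on_left_branch (x_ref α_on α_off β : ℝ)
    (hx : 0 < x_ref) (hα : 0 < α_on) (hα2 : α_on < Real.log 2)
    (hβ1 : 2 * x_ref * α_on < β)
    (hβ2 : β < (Real.exp α_on / (Real.exp α_on - 1)) * x_ref * α_on)
    (hoff1 : α_on < α_off)
    (hoff2 : α_off < ((β / α_on - x_ref) / x_ref) * α_on) :
    ∀ x ∈ Set.Icc 0 (xBorder α_on β x_ref), x < strobo α_on α_off β x_ref x := by
  rintro x ⟨-, hxb⟩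
  have h_ref : x_ref < β / α_on := by
    rw [lt_div_iff₀ hα]
    nlinarith [mul_pos hx hα]
  have h_lt : x < β / α_on := by
    unfold xBorder at hxb
    nlinarith [mul_pos (sub_pos.2 h_ref) (Real.exp_pos α_on)]
  have h_exp : Real.exp (-α_on) < 1 := Real.exp_lt_one_iff.mpr (neg_lt_zero.2 hα)
  rw [strobo, if_pos hxb]
  nlinarith [mul_pos (sub_pos.2 h_lt) (sub_pos.2 h_exp)]
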